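/- Let n ≥ 3 and Ω ⊂ ℝⁿ bounded. If u is a positive Dirichlet eigenfunction of −Δ on Ω with eigenvalue λ (a first eigenfunction of a nodal domain), then Vol(Ω) ≥ (2(n−2))^{n/2} αₙ λ^{−n/2}. -/

import Mathlib

open MeasureTheory Metric Real

/-- The Euclidean Laplacian of `u : ℝⁿ → ℝ`, as the sum of the second partial
derivatives in the coordinate directions. -/
noncomputable def euclLap (n : ℕ) (u : EuclideanSpace ℝ (Fin n) → ℝ)
    (x : EuclideanSpace ℝ (Fin n)) : ℝ :=
  ∑ i : Fin n,
    fderiv ℝ (fun y => fderiv ℝ u y (EuclideanSpace.single i (1 : ℝ))) x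
      (EuclideanSpace.single i (1 : ℝ))

open Filter Topology in
theorem euclLap_congr {n : ℕ} {f g : EuclideanSpace ℝ (Fin n) → ℝ}
    {x : EuclideanSpace ℝ (Fin n)} (h : f =ᶠ[𝓝 x] g) : euclLap n f x = euclLap n g x := by
  unfold euclLap
  refine Finset.sum_congr rfl fun i _ => ?_
  have h2 : (fun y : EuclideanSpace ℝ (Fin n) => fderiv ℝ f y (EuclideanSpace.single i (1 : ℝ)))
      =ᶠ[𝓝 x] fun y => fderiv ℝ g y (EuclideanSpace.single i (1 : ℝ)) := by
    filter_upwards [h.fderiv (𝕜 := ℝ)] with y hy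
    rw [hy]
  rw [h2.fderiv_eq]

theorem ContDiff.fderiv_apply_const {E : Type*} [NormedAddCommGroup E] [NormedSpace ℝ E]
    {f : E → ℝ} (hf : ContDiff ℝ 2 f) (v : E) : ContDiff ℝ 1 fun y => fderiv ℝ f y v :=
  (hf.fderiv_right (m := 1) (by norm_num)).clm_apply contDiff_const

theorem HasCompactSupport.fderiv_apply_const {E : Type*} [NormedAddCommGroup E] [NormedSpace ℝ E]
    {f : E → ℝ} (hf : HasCompactSupport f) (v : E) :
    HasCompactSupport fun y => fderiv ℝ f y v :=
  (hf.fderiv ℝ).comp_left (g := fun L : E →L[ℝ] ℝ => L v) (by simp)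

theorem continuous_euclLap {n : ℕ} {f : EuclideanSpace ℝ (Fin n) → ℝ} (hf : ContDiff ℝ 2 f) :
    Continuous (euclLap n f) :=
  continuous_finsetSum _ fun _ _ =>
    ((hf.fderiv_apply_const _).continuous_fderiv (by norm_num)).clm_apply continuous_const

/-- Integration by parts for two derivatives in the same direction. -/
theorem integral_mul_fderiv_fderiv_eq {E : Type*} [NormedAddCommGroup E] [NormedSpace ℝ E]
    [FiniteDimensional ℝ E] [MeasurableSpace E] [BorelSpace E] (μ : Measure E)
    [μ.IsAddHaarMeasure] {w g : E → ℝ} (hw : ContDiff ℝ 2 w) (hwc : HasCompactSupport w)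
    (hg : ContDiff ℝ 2 g) (v : E) :
    ∫ x, w x * fderiv ℝ (fun y => fderiv ℝ g y v) x v ∂μ =
      ∫ x, fderiv ℝ (fun y => fderiv ℝ w y v) x v * g x ∂μ := by
  have hw1 := hw.fderiv_apply_const v
  have hg1 := hg.fderiv_apply_const v
  have hw1c := hwc.fderiv_apply_const v
  have hw2 : Continuous fun x => fderiv ℝ (fun y => fderiv ℝ w y v) x v :=
    (hw1.continuous_fderiv (by norm_num)).clm_apply continuous_const
  have hg2 : Continuous fun x => fderiv ℝ (fun y => fderiv ℝ g y v) x v :=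
    (hg1.continuous_fderiv (by norm_num)).clm_apply continuous_const
  have hw2c := hw1c.fderiv_apply_const v
  have i1 : Integrable (fun x => fderiv ℝ w x v * fderiv ℝ g x v) μ :=
    (hw1.continuous.mul hg1.continuous).integrable_of_hasCompactSupport hw1c.mul_right
  have i2 : Integrable (fun x => w x * fderiv ℝ (fun y => fderiv ℝ g y v) x v) μ :=
    (hw.continuous.mul hg2).integrable_of_hasCompactSupport hwc.mul_right
  have i3 : Integrable (fun x => w x * fderiv ℝ g x v) μ :=
    (hw.continuous.mul hg1.continuous).integrable_of_hasCompactSupport hwc.mul_right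
  have i4 : Integrable (fun x => fderiv ℝ (fun y => fderiv ℝ w y v) x v * g x) μ :=
    (hw2.mul hg.continuous).integrable_of_hasCompactSupport hw2c.mul_right
  have i5 : Integrable (fun x => fderiv ℝ w x v * g x) μ :=
    (hw1.continuous.mul hg.continuous).integrable_of_hasCompactSupport hw1c.mul_right
  rw [integral_mul_fderiv_eq_neg_fderiv_mul_of_integrable i1 i2 i3
      (fun x _ => hw.differentiable (by norm_num) x)
      (fun x _ => hg1.differentiable (by norm_num) x),
    integral_mul_fderiv_eq_neg_fderiv_mul_of_integrable i4 i1 i5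
      (fun x _ => hw1.differentiable (by norm_num) x)
      (fun x _ => hg.differentiable (by norm_num) x), neg_neg]

/-- Green's second identity on the whole space, one function being compactly supported. -/
theorem integral_mul_euclLap {n : ℕ} {w g : EuclideanSpace ℝ (Fin n) → ℝ}
    (hw : ContDiff ℝ 2 w) (hwc : HasCompactSupport w) (hg : ContDiff ℝ 2 g) :
    ∫ x, w x * euclLap n g x = ∫ x, euclLap n w x * g x := by
  simp only [euclLap, Finset.mul_sum, Finset.sum_mul]
  rw [integral_finsetSum, integral_finsetSum]
  · exact Finset.sum_congr rfl fun i _ => integral_mul_fderiv_fderiv_eq volume hw hwc hg _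
  · intro i _
    exact ((((hw.fderiv_apply_const _).continuous_fderiv (by norm_num)).clm_apply
      continuous_const).mul hg.continuous).integrable_of_hasCompactSupport
      ((hwc.fderiv_apply_const _).fderiv_apply_const _).mul_right
  · intro i _
    exact (hw.continuous.mul (((hg.fderiv_apply_const _).continuous_fderiv (by norm_num)).clm_apply
      continuous_const)).integrable_of_hasCompactSupport hwc.mul_right

open Filter Topology in
/-- The chain rule for the Laplacian. -/
theorem euclLap_comp {n : ℕ} {ψ χ : ℝ → ℝ} {u : EuclideanSpace ℝ (Fin n) → ℝ}
    {x : EuclideanSpace ℝ (Fin n)} (hψ : ∀ t, HasDerivAt ψ (χ t) t) (hχ : Differentiable ℝ χ)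
    (hu : ContDiffAt ℝ 2 u x) :
    euclLap n (ψ ∘ u) x = χ (u x) * euclLap n u x +
      deriv χ (u x) * ∑ i, fderiv ℝ u x (EuclideanSpace.single i (1 : ℝ)) ^ 2 := by
  unfold euclLap
  rw [Finset.mul_sum, Finset.mul_sum, ← Finset.sum_add_distrib]
  refine Finset.sum_congr rfl fun i _ => ?_
  set v := EuclideanSpace.single i (1 : ℝ)
  have h1 : (fun y => fderiv ℝ (ψ ∘ u) y v) =ᶠ[𝓝 x] fun y => χ (u y) * fderiv ℝ u y v := by
    filter_upwards [hu.eventually (by simp)] with y hy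
    rw [((hψ (u y)).comp_hasFDerivAt y (hy.differentiableAt (by norm_num)).hasFDerivAt).fderiv]
    simp
  have h2 : DifferentiableAt ℝ (fun y => fderiv ℝ u y v) x :=
    ((hu.fderiv_right (m := 1) (by norm_num)).clm_apply contDiffAt_const).differentiableAt
      (by norm_num)
  have h3 : HasFDerivAt (fun y => χ (u y)) (deriv χ (u x) • fderiv ℝ u x) x :=
    (hχ (u x)).hasDerivAt.comp_hasFDerivAt x (hu.differentiableAt (by norm_num)).hasFDerivAt
  rw [h1.fderiv_eq, (h3.fun_mul h2.hasFDerivAt).fderiv]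
  simp
  ring

/-- A smooth convex approximation of the positive part, vanishing up to height `δ`. -/
theorem exists_convex_truncation {δ : ℝ} (hδ : 0 < δ) :
    ∃ ψ χ : ℝ → ℝ, ContDiff ℝ 2 ψ ∧ (∀ t, HasDerivAt ψ (χ t) t) ∧ Differentiable ℝ χ ∧
      Monotone χ ∧ (∀ t, 0 ≤ χ t) ∧ (∀ t, χ t ≤ 1) ∧ (∀ t ≤ δ, ψ t = 0) ∧
      ∀ t, t - 2 * δ ≤ ψ t := by
  set χ : ℝ → ℝ := fun t => smoothTransition (t / δ - 1) with hχ
  have hχs : ContDiff ℝ 1 χ :=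
    smoothTransition.contDiff.comp ((contDiff_id.div_const δ).sub contDiff_const)
  have hχ0 : ∀ t, 0 ≤ χ t := fun t => smoothTransition.nonneg _
  have hzero : ∀ t ≤ δ, χ t = 0 := fun t ht =>
    smoothTransition.zero_of_nonpos (by rw [sub_nonpos, div_le_one hδ]; exact ht)
  have hone : ∀ t, 2 * δ ≤ t → χ t = 1 := fun t ht =>
    smoothTransition.one_of_one_le (by rw [le_sub_iff_add_le, le_div_iff₀ hδ]; linarith)
  have hd : ∀ t, HasDerivAt (fun t => ∫ s in δ..t, χ s) (χ t) t := fun t =>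
    (hχs.continuous.integral_hasStrictDerivAt δ t).hasDerivAt
  refine ⟨fun t => ∫ s in δ..t, χ s, χ, ?_, hd, hχs.differentiable (by norm_num), ?_, hχ0,
    fun t => smoothTransition.le_one _, ?_, ?_⟩
  · rw [show (2 : WithTop ℕ∞) = 1 + 1 by norm_num, contDiff_succ_iff_deriv]
    refine ⟨fun t => (hd t).differentiableAt, by simp, ?_⟩
    rwa [show deriv (fun t => ∫ s in δ..t, χ s) = χ from funext fun t => (hd t).deriv]
  · intro a b hab
    apply smoothTransition.monotone
    gcongr
  · intro t ht
    beta_reduce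
    rw [intervalIntegral.integral_congr (g := fun _ => (0 : ℝ))]
    · simp
    · intro s hs
      rw [Set.uIcc_of_ge ht] at hs
      exact hzero s hs.2
  · intro t
    beta_reduce
    have hint : ∀ a b, IntervalIntegrable χ volume a b := fun a b =>
      hχs.continuous.intervalIntegrable a b
    rcases le_total t (2 * δ) with ht | ht
    · rcases le_total t δ with ht' | ht'
      · rw [intervalIntegral.integral_congr (g := fun _ => (0 : ℝ))]
        · simp; linarith
        · intro s hs
          rw [Set.uIcc_of_ge ht'] at hs
          exact hzero s hs.2
      · have := intervalIntegral.integral_nonneg (μ := volume) ht' fun s _ => hχ0 s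
        linarith
    · rw [← intervalIntegral.integral_add_adjacent_intervals (hint δ (2 * δ)) (hint (2 * δ) t),
        intervalIntegral.integral_congr (a := 2 * δ) (b := t) (g := fun _ => (1 : ℝ))]
      · have := intervalIntegral.integral_nonneg (μ := volume) (by linarith : δ ≤ 2 * δ)
          fun s _ => hχ0 s
        simp; linarith
      · intro s hs
        rw [Set.uIcc_of_le ht] at hs
        exact hone s hs.1

open Filter Topology in
/-- A positive Dirichlet eigenfunction is approximated by compactly supported `C²` functions
whose negative Laplacian is controlled by `lam * M` on the domain. -/
theorem exists_compactly_supported_approx {n : ℕ} {Ω : Set (EuclideanSpace ℝ (Fin n))}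
    (hΩopen : IsOpen Ω) (hΩbd : Bornology.IsBounded Ω)
    {u : EuclideanSpace ℝ (Fin n) → ℝ} {lam M : ℝ} (hlam : 0 < lam)
    (hcont : ContinuousOn u (closure Ω))
    (hsmooth : ∀ x ∈ Ω, ContDiffAt ℝ 2 u x)
    (heig : ∀ x ∈ Ω, euclLap n u x = -lam * u x)
    (hpos : ∀ x ∈ Ω, 0 < u x)
    (hbdry : ∀ x ∈ frontier Ω, u x = 0) (hM : ∀ x ∈ Ω, u x ≤ M) {δ : ℝ} (hδ : 0 < δ) :
    ∃ w : EuclideanSpace ℝ (Fin n) → ℝ, ContDiff ℝ 2 w ∧ HasCompactSupport w ∧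
      (∀ x, -euclLap n w x ≤ Ω.indicator (fun _ => lam * M) x) ∧
      ∀ x ∈ Ω, u x - 2 * δ ≤ w x := by
  obtain ⟨ψ, χ, hψs, hψ, hχ, hχm, hχ0, hχ1, hψ0, hψl⟩ := exists_convex_truncation hδ
  set K : Set (EuclideanSpace ℝ (Fin n)) := closure Ω ∩ u ⁻¹' Set.Ici δ
  have hKc : IsClosed K := hcont.preimage_isClosed_of_isClosed isClosed_closure isClosed_Ici
  have hKk : IsCompact K := hΩbd.isCompact_closure.of_isClosed_subset hKc Set.inter_subset_left
  have hKΩ : K ⊆ Ω := by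
    rintro x ⟨hx, hx'⟩
    by_contra hxΩ
    have : u x = 0 := hbdry x ⟨hx, by rwa [hΩopen.interior_eq]⟩
    simp only [Set.mem_preimage, Set.mem_Ici, this] at hx'
    linarith
  have hwK : ∀ x, x ∉ K → Ω.indicator (ψ ∘ u) x = 0 := by
    intro x hx
    by_cases hxΩ : x ∈ Ω
    · rw [Set.indicator_of_mem hxΩ]
      refine hψ0 _ (le_of_lt ?_)
      by_contra hlt
      exact hx ⟨subset_closure hxΩ, not_lt.1 hlt⟩
    · exact Set.indicator_of_notMem hxΩ _
  have hin : ∀ x ∈ Ω, Ω.indicator (ψ ∘ u) =ᶠ[𝓝 x] ψ ∘ u := fun x hx => by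
    filter_upwards [hΩopen.mem_nhds hx] with y hy
    exact Set.indicator_of_mem hy _
  have hout : ∀ x ∉ Ω, Ω.indicator (ψ ∘ u) =ᶠ[𝓝 x] fun _ => 0 := fun x hx => by
    filter_upwards [hKc.isOpen_compl.mem_nhds fun h => hx (hKΩ h)] with y hy
    exact hwK y hy
  refine ⟨Ω.indicator (ψ ∘ u), ?_, HasCompactSupport.intro hKk hwK, ?_, ?_⟩
  · rw [contDiff_iff_contDiffAt]
    intro x
    by_cases hx : x ∈ Ω
    · exact (hψs.contDiffAt.comp x (hsmooth x hx)).congr_of_eventuallyEq (hin x hx)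
    · exact contDiffAt_const.congr_of_eventuallyEq (hout x hx)
  · intro x
    by_cases hx : x ∈ Ω
    · rw [Set.indicator_of_mem hx, euclLap_congr (hin x hx),
        euclLap_comp hψ hχ (hsmooth x hx), heig x hx]
      have h1 : 0 ≤ deriv χ (u x) *
          ∑ i, fderiv ℝ u x (EuclideanSpace.single i (1 : ℝ)) ^ 2 :=
        mul_nonneg hχm.deriv_nonneg (Finset.sum_nonneg fun i _ => sq_nonneg _)
      have h2 : χ (u x) * (lam * u x) ≤ 1 * (lam * M) :=
        mul_le_mul (hχ1 _) (mul_le_mul_of_nonneg_left (hM x hx) hlam.le)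
          (mul_pos hlam (hpos x hx)).le zero_le_one
      linarith
    · rw [Set.indicator_of_notMem hx, euclLap_congr (hout x hx)]
      simp [euclLap]
  · intro x hx
    rw [Set.indicator_of_mem hx]
    exact hψl _

theorem pow_mul_one_add_sq_rpow_le_one {z : ℝ} (hz : 0 ≤ z) (k : ℕ) :
    z ^ k * (1 + z ^ 2) ^ (-((k : ℝ) / 2)) ≤ 1 := by
  have h0 : (0 : ℝ) < 1 + z ^ 2 := by positivity
  rw [rpow_neg h0.le, ← div_eq_mul_inv, div_le_one (by positivity)]
  calc z ^ k = (z ^ 2) ^ ((k : ℝ) / 2) := by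
        rw [← rpow_natCast z 2, ← rpow_mul hz, Nat.cast_ofNat,
          mul_div_cancel₀ _ (two_ne_zero), rpow_natCast]
    _ ≤ (1 + z ^ 2) ^ ((k : ℝ) / 2) := by gcongr; linarith

theorem hasFDerivAt_one_add_sq_norm_rpow {E : Type*} [NormedAddCommGroup E]
    [InnerProductSpace ℝ E] (c s : ℝ) (x₀ y : E) :
    HasFDerivAt (fun y => (1 + c ^ 2 * ‖y - x₀‖ ^ 2) ^ s)
      ((2 * s * c ^ 2 * (1 + c ^ 2 * ‖y - x₀‖ ^ 2) ^ (s - 1)) • innerSL ℝ (y - x₀)) y := by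
  have h1 : HasFDerivAt (fun y => 1 + c ^ 2 * ‖y - x₀‖ ^ 2)
      (c ^ 2 • (2 • innerSL ℝ (y - x₀))) y := by
    have := (((hasFDerivAt_id y).sub_const x₀).norm_sq.const_mul (c ^ 2)).const_add 1
    simpa using this
  have h2 := h1.rpow_const (p := s) (Or.inl (by positivity))
  convert! h2 using 1
  ext v
  simp
  ring

theorem contDiff_one_add_sq_norm_rpow {E : Type*} [NormedAddCommGroup E]
    [InnerProductSpace ℝ E] (c s : ℝ) (x₀ : E) :
    ContDiff ℝ 2 fun y => (1 + c ^ 2 * ‖y - x₀‖ ^ 2) ^ s := by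
  refine ContDiff.rpow_const_of_ne ?_ fun y => by positivity
  exact contDiff_const.add (contDiff_const.mul ((contDiff_id.sub contDiff_const).norm_sq ℝ))

/-- The Laplacian of the regularized Newtonian kernel. -/
theorem euclLap_one_add_sq_norm_rpow (n : ℕ) (c : ℝ) (x₀ y : EuclideanSpace ℝ (Fin n)) :
    euclLap n (fun y => (1 + c ^ 2 * ‖y - x₀‖ ^ 2) ^ (1 - (n : ℝ) / 2)) y =
      -(n * (n - 2) * c ^ 2 * (1 + c ^ 2 * ‖y - x₀‖ ^ 2) ^ (-((n : ℝ) / 2 + 1))) := by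
  set s : ℝ := 1 - (n : ℝ) / 2 with hs
  set Q : ℝ := 1 + c ^ 2 * ‖y - x₀‖ ^ 2 with hQ
  have hQ0 : 0 < Q := by positivity
  have key : ∀ i : Fin n, fderiv ℝ (fun z => fderiv ℝ
      (fun y => (1 + c ^ 2 * ‖y - x₀‖ ^ 2) ^ s) z (EuclideanSpace.single i (1 : ℝ))) y
      (EuclideanSpace.single i (1 : ℝ)) =
      2 * s * c ^ 2 * Q ^ (s - 1) +
        4 * s * (s - 1) * c ^ 4 * Q ^ (s - 1 - 1) * (y i - x₀ i) ^ 2 := by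
    intro i
    have h1 : (fun z => fderiv ℝ
        (fun y => (1 + c ^ 2 * ‖y - x₀‖ ^ 2) ^ s) z (EuclideanSpace.single i (1 : ℝ))) =
        fun z => 2 * s * c ^ 2 * ((1 + c ^ 2 * ‖z - x₀‖ ^ 2) ^ (s - 1) * (z i - x₀ i)) := by
      funext z
      rw [(hasFDerivAt_one_add_sq_norm_rpow c s x₀ z).fderiv]
      simp [EuclideanSpace.inner_single_right]
      ring
    have h2 : HasFDerivAt (fun z : EuclideanSpace ℝ (Fin n) => z i - x₀ i)
        (EuclideanSpace.proj i : EuclideanSpace ℝ (Fin n) →L[ℝ] ℝ) y :=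
      (EuclideanSpace.proj i : EuclideanSpace ℝ (Fin n) →L[ℝ] ℝ).hasFDerivAt.sub_const _
    have h3 := ((hasFDerivAt_one_add_sq_norm_rpow c (s - 1) x₀ y).fun_mul h2).const_mul
      (2 * s * c ^ 2)
    rw [h1, h3.fderiv]
    simp [EuclideanSpace.inner_single_right, ← hQ]
    ring
  unfold euclLap
  rw [Finset.sum_congr rfl fun i _ => key i, Finset.sum_add_distrib, Finset.sum_const,
    ← Finset.mul_sum]
  have hn : ∑ i, (y i - x₀ i) ^ 2 = ‖y - x₀‖ ^ 2 := by
    rw [EuclideanSpace.real_norm_sq_eq]; simp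
  have e1 : Q ^ (s - 1) = Q ^ (s - 1 - 1) * Q := by
    rw [← rpow_add_one hQ0.ne']; ring_nf
  have e2 : s - 1 - 1 = -((n : ℝ) / 2 + 1) := by rw [hs]; ring
  rw [hn, e1, e2, Finset.card_univ, Fintype.card_fin, nsmul_eq_mul, hQ, hs]
  ring

open Filter Topology Module in
theorem integral_one_add_sq_norm_rpow {E : Type*} [NormedAddCommGroup E] [NormedSpace ℝ E]
    [FiniteDimensional ℝ E] [Nontrivial E] [MeasurableSpace E] [BorelSpace E] (μ : Measure E)
    [μ.IsAddHaarMeasure] :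
    ∫ x, (1 + ‖x‖ ^ 2) ^ (-((finrank ℝ E : ℝ) / 2 + 1)) ∂μ = μ.real (ball 0 1) := by
  set n := finrank ℝ E with hn
  have hn0 : 0 < n := finrank_pos
  set s : ℝ := -((n : ℝ) / 2) with hs
  have hd : ∀ t ∈ Set.Ici (0 : ℝ), HasDerivAt (fun t : ℝ => t ^ n * (1 + t ^ 2) ^ s)
      (n * (t ^ (n - 1) • (1 + t ^ 2) ^ (-((n : ℝ) / 2 + 1)))) t := by
    intro t _
    have hQ : (0 : ℝ) < 1 + t ^ 2 := by positivity
    have h1 : HasDerivAt (fun t : ℝ => 1 + t ^ 2) (2 * t) t := by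
      simpa using (hasDerivAt_pow 2 t).const_add 1
    have h2 := (hasDerivAt_pow n t).fun_mul (h1.rpow_const (p := s) (Or.inl hQ.ne'))
    convert! h2 using 1
    have e1 : (1 + t ^ 2) ^ s = (1 + t ^ 2) ^ (s - 1) * (1 + t ^ 2) := by
      rw [← rpow_add_one hQ.ne']; ring_nf
    have e2 : -((n : ℝ) / 2 + 1) = s - 1 := by rw [hs]; ring
    have e3 : t ^ n = t ^ (n - 1) * t := by rw [← pow_succ, Nat.sub_add_cancel hn0]
    rw [e1, e2, e3, smul_eq_mul, hs]
    ring
  have hlim : Tendsto (fun t : ℝ => t ^ n * (1 + t ^ 2) ^ s) atTop (𝓝 1) := by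
    have h1 : Tendsto (fun t : ℝ => (1 + (t⁻¹) ^ 2) ^ s) atTop (𝓝 ((1 + 0 ^ 2) ^ s)) :=
      ((tendsto_inv_atTop_zero.pow 2).const_add 1).rpow_const (Or.inl (by norm_num))
    rw [show ((1 : ℝ) + 0 ^ 2) ^ s = 1 by norm_num] at h1
    refine h1.congr' ?_
    filter_upwards [eventually_gt_atTop 0] with t ht
    have e1 : t ^ n = (t ^ 2) ^ (-s) := by
      rw [← rpow_natCast t 2, ← rpow_mul ht.le, hs, Nat.cast_ofNat, neg_neg,
        mul_div_cancel₀ _ two_ne_zero, rpow_natCast]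
    have e2 : 1 + (t⁻¹) ^ 2 = (1 + t ^ 2) / t ^ 2 := by field_simp; ring
    rw [e1, e2, div_rpow (by positivity) (by positivity), rpow_neg (by positivity)]
    field_simp
    rw [← rpow_add (by positivity)]
    simp
  have hI := integral_Ioi_of_hasDerivAt_of_nonneg' hd (fun t ht => by
    have : (0 : ℝ) < t := ht
    simp only [smul_eq_mul]; positivity) hlim
  rw [integral_const_mul] at hI
  rw [integral_fun_norm_addHaar μ (fun t : ℝ => (1 + t ^ 2) ^ (-((n : ℝ) / 2 + 1))), nsmul_eq_mul,
    smul_eq_mul, ← hn, mul_left_comm, hI]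
  simp [hn0.ne']

/-- The bathtub principle: among sets of given measure, the integral is largest on a
superlevel set. -/
theorem setIntegral_le_setIntegral_of_superlevel {X : Type*} [MeasurableSpace X] {μ : Measure X}
    {A B : Set X} (hA : MeasurableSet A) (hB : MeasurableSet B) (hAfin : μ A ≠ ⊤)
    (hAB : μ A = μ B) {h : X → ℝ} (hhA : IntegrableOn h A μ) (hhB : IntegrableOn h B μ) (c : ℝ)
    (h_in : ∀ x ∈ B, c ≤ h x) (h_out : ∀ x ∉ B, h x ≤ c) :
    ∫ x in A, h x ∂μ ≤ ∫ x in B, h x ∂μ := by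
  have cA : IntegrableOn (fun _ => c) A μ := integrableOn_const hAfin
  have cB : IntegrableOn (fun _ => c) B μ := integrableOn_const (hAB ▸ hAfin)
  have key : ∫ x in A, (h x - c) ∂μ ≤ ∫ x in B, (h x - c) ∂μ := by
    rw [← integral_indicator hA, ← integral_indicator hB]
    refine integral_mono ((hhA.sub cA).integrable_indicator hA)
      ((hhB.sub cB).integrable_indicator hB) fun x => ?_
    by_cases hxA : x ∈ A <;> by_cases hxB : x ∈ B
    · simp [hxA, hxB]
    · simpa [hxA, hxB] using h_out x hxB
    · simpa [hxA, hxB] using h_in x hxB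
    · simp [hxA, hxB]
  rw [integral_sub hhA cA, integral_sub hhB cB, setIntegral_const, setIntegral_const,
    measureReal_def, measureReal_def, hAB] at key
  linarith

open Module in
/-- Integrals of the regularized Newtonian kernel are bounded by those of the Newtonian kernel
over the ball of the same volume. -/
theorem setIntegral_one_add_sq_norm_rpow_le {E : Type*} [NormedAddCommGroup E] [NormedSpace ℝ E]
    [FiniteDimensional ℝ E] [Nontrivial E] [MeasurableSpace E] [BorelSpace E] (μ : Measure E)
    [μ.IsAddHaarMeasure] (hdim : 2 ≤ finrank ℝ E) {Ω : Set E} (hΩ : MeasurableSet Ω)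
    (hΩb : Bornology.IsBounded Ω) {r : ℝ} (hr : 0 ≤ r) {c : ℝ} (hc : 0 < c) (x₀ : E)
    (hvol : μ Ω = μ (ball x₀ r)) :
    c ^ (finrank ℝ E - 2) *
        ∫ y in Ω, (1 + c ^ 2 * ‖y - x₀‖ ^ 2) ^ (1 - (finrank ℝ E : ℝ) / 2) ∂μ ≤
      finrank ℝ E * μ.real (ball 0 1) * (r ^ 2 / 2) := by
  set n := finrank ℝ E with hn
  set k := n - 2 with hk
  have hnk : n = k + 2 := by omega
  have hexp : 1 - (n : ℝ) / 2 = -((k : ℝ) / 2) := by rw [hnk]; push_cast; ring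
  rw [hexp]
  set f : ℝ → ℝ := fun t => (1 + c ^ 2 * t ^ 2) ^ (-((k : ℝ) / 2)) with hf
  have hf0 : ∀ t, 0 ≤ f t := fun t => by positivity
  have hfanti : ∀ a b, 0 ≤ a → a ≤ b → f b ≤ f a := fun a b ha hab =>
    rpow_le_rpow_of_nonpos (by positivity) (by gcongr) (by
      have : (0 : ℝ) ≤ (k : ℝ) / 2 := by positivity
      linarith)
  have hfc : Continuous fun y : E => f ‖y - x₀‖ := by
    refine Continuous.rpow_const (by fun_prop) fun y => Or.inl (by positivity)
  have hloc : LocallyIntegrable (fun y : E => f ‖y - x₀‖) μ := hfc.locallyIntegrable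
  have hint : ∀ S : Set E, Bornology.IsBounded S → IntegrableOn (fun y : E => f ‖y - x₀‖) S μ :=
    fun S hS => (hloc.integrableOn_isCompact hS.isCompact_closure).mono_set subset_closure
  have h1 : ∫ y in Ω, f ‖y - x₀‖ ∂μ ≤ ∫ y in ball x₀ r, f ‖y - x₀‖ ∂μ := by
    refine setIntegral_le_setIntegral_of_superlevel hΩ measurableSet_ball
      hΩb.measure_lt_top.ne hvol (hint _ hΩb) (hint _ isBounded_ball) (f r) ?_ ?_
    · intro y hy
      rw [mem_ball, dist_eq_norm] at hy
      exact hfanti _ _ (norm_nonneg _) hy.le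
    · intro y hy
      rw [mem_ball, dist_eq_norm, not_lt] at hy
      exact hfanti _ _ hr hy
  have h2 : ∫ y in ball x₀ r, f ‖y - x₀‖ ∂μ = ∫ y, (Set.Iio r).indicator f ‖y‖ ∂μ := by
    rw [← integral_sub_right_eq_self (fun y => (Set.Iio r).indicator f ‖y‖) x₀,
      ← integral_indicator measurableSet_ball]
    congr 1
    funext y
    by_cases hy : ‖y - x₀‖ < r <;> simp [Set.indicator, mem_ball, dist_eq_norm, hy]
  rw [integral_fun_norm_addHaar, nsmul_eq_mul, smul_eq_mul] at h2
  have h3 : c ^ k * ∫ y in Set.Ioi (0 : ℝ), y ^ (finrank ℝ E - 1) • (Set.Iio r).indicator f y ≤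
      r ^ 2 / 2 := by
    have hid : ∫ y in Set.Ioi (0 : ℝ), (Set.Iio r).indicator (fun y => y) y = r ^ 2 / 2 := by
      rw [setIntegral_indicator measurableSet_Iio, Set.Ioi_inter_Iio,
        ← integral_Ioc_eq_integral_Ioo, ← intervalIntegral.integral_of_le hr, integral_id]
      ring
    rw [← integral_const_mul, ← hid]
    refine integral_mono_of_nonneg ?_ ?_ ?_
    · refine (ae_restrict_mem measurableSet_Ioi).mono fun y hy => ?_
      have hy : (0 : ℝ) < y := hy
      have : 0 ≤ (Set.Iio r).indicator f y := Set.indicator_nonneg (fun t _ => hf0 t) y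
      simp only [Pi.zero_apply, smul_eq_mul]
      positivity
    · rw [integrable_indicator_iff measurableSet_Iio, IntegrableOn,
        Measure.restrict_restrict measurableSet_Iio]
      exact (continuous_id.integrableOn_Icc (a := 0) (b := r)).mono_set
        fun y hy => ⟨le_of_lt hy.2, le_of_lt hy.1⟩
    · refine (ae_restrict_mem measurableSet_Ioi).mono fun y hy => ?_
      have hy : (0 : ℝ) < y := hy
      by_cases hyr : y ∈ Set.Iio r
      · simp only [Set.indicator_of_mem hyr, smul_eq_mul, hf]
        have h := pow_mul_one_add_sq_rpow_le_one (mul_pos hc hy).le k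
        rw [mul_pow, mul_pow] at h
        have e : finrank ℝ E - 1 = k + 1 := by omega
        rw [e, pow_succ]
        calc c ^ k * (y ^ k * y * (1 + c ^ 2 * y ^ 2) ^ (-((k : ℝ) / 2)))
            = (c ^ k * y ^ k * (1 + c ^ 2 * y ^ 2) ^ (-((k : ℝ) / 2))) * y := by ring
          _ ≤ 1 * y := by gcongr
          _ = y := one_mul y
      · simp [Set.indicator_of_notMem hyr]
  calc c ^ k * ∫ y in Ω, f ‖y - x₀‖ ∂μ
      ≤ c ^ k * (n * (μ.real (ball 0 1) *
          ∫ y in Set.Ioi (0 : ℝ), y ^ (finrank ℝ E - 1) • (Set.Iio r).indicator f y)) := by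
        rw [hn, ← h2]; gcongr
    _ = n * μ.real (ball 0 1) * (c ^ k *
          ∫ y in Set.Ioi (0 : ℝ), y ^ (finrank ℝ E - 1) • (Set.Iio r).indicator f y) := by ring
    _ ≤ n * μ.real (ball 0 1) * (r ^ 2 / 2) := by gcongr

open Filter Topology Module Bornology in
theorem tendsto_norm_pow_mul_one_add_sq_rpow {E : Type*} [NormedAddCommGroup E] (n : ℕ) :
    Tendsto (fun x : E => ‖x‖ ^ n * (1 + ‖x‖ ^ 2) ^ (-((n : ℝ) / 2 + 1))) (cobounded E) (𝓝 0) := by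
  have h1 : Tendsto (fun x : E => (1 + ‖x‖ ^ 2)⁻¹) (cobounded E) (𝓝 0) :=
    tendsto_inv_atTop_zero.comp (tendsto_atTop_add_const_left _ _
      ((tendsto_pow_atTop two_ne_zero).comp tendsto_norm_cobounded_atTop))
  refine squeeze_zero (fun x => by positivity) (fun x => ?_) h1
  have hQ : (0 : ℝ) < 1 + ‖x‖ ^ 2 := by positivity
  rw [neg_add, rpow_add hQ, rpow_neg_one, ← mul_assoc]
  exact mul_le_of_le_one_left (by positivity)
    (pow_mul_one_add_sq_rpow_le_one (norm_nonneg x) n)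

open Filter Topology Module in
/-- A pointwise bound for compactly supported functions with bounded negative Laplacian, supported
in a set of the volume of a ball of radius `r`. -/
theorem le_of_neg_euclLap_le {n : ℕ} (hn : 3 ≤ n) {Ω : Set (EuclideanSpace ℝ (Fin n))}
    (hΩopen : IsOpen Ω) (hΩbd : Bornology.IsBounded Ω) {r : ℝ} (hr : 0 ≤ r)
    (x₀ : EuclideanSpace ℝ (Fin n)) (hvol : volume Ω = volume (ball x₀ r))
    {w : EuclideanSpace ℝ (Fin n) → ℝ} (hw : ContDiff ℝ 2 w) (hwc : HasCompactSupport w)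
    {C : ℝ} (hC : 0 ≤ C) (hlap : ∀ x, -euclLap n w x ≤ Ω.indicator (fun _ => C) x) :
    2 * ((n : ℝ) - 2) * w x₀ ≤ C * r ^ 2 := by
  have : Nonempty (Fin n) := ⟨⟨0, by omega⟩⟩
  have hfin : finrank ℝ (EuclideanSpace ℝ (Fin n)) = n := by simp
  have hnR : (3 : ℝ) ≤ n := by exact_mod_cast hn
  set α : ℝ := volume.real (ball (0 : EuclideanSpace ℝ (Fin n)) 1) with hα
  have hα0 : 0 < α :=
    ENNReal.toReal_pos (measure_ball_pos _ _ one_pos).ne' measure_ball_lt_top.ne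
  set p : ℝ := -((n : ℝ) / 2 + 1) with hp
  set φ : EuclideanSpace ℝ (Fin n) → ℝ := fun x => α⁻¹ * (1 + ‖x‖ ^ 2) ^ p with hφ
  have hφ1 : ∫ x, φ x = 1 := by
    have := integral_one_add_sq_norm_rpow (volume : Measure (EuclideanSpace ℝ (Fin n)))
    rw [hfin] at this
    rw [integral_const_mul, this, inv_mul_cancel₀ hα0.ne']
  have hφt : Tendsto (fun x => ‖x‖ ^ finrank ℝ (EuclideanSpace ℝ (Fin n)) * φ x)
      (Bornology.cobounded _) (𝓝 0) := by
    have := (tendsto_norm_pow_mul_one_add_sq_rpow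
      (E := EuclideanSpace ℝ (Fin n)) n).const_mul α⁻¹
    rw [mul_zero] at this
    refine this.congr fun x => ?_
    rw [hfin]
    ring
  have hlim := tendsto_integral_comp_smul_smul_of_integrable' (μ := volume) (x₀ := x₀)
    (fun x => by positivity) hφ1 hφt (hw.continuous.integrable_of_hasCompactSupport hwc)
    hw.continuous.continuousAt
  rw [hfin] at hlim
  have hbound : ∀ c : ℝ, 0 < c →
      ∫ x, (c ^ n * φ (c • (x₀ - x))) • w x ≤ C * r ^ 2 / (2 * ((n : ℝ) - 2)) := by
    intro c hc
    set g : EuclideanSpace ℝ (Fin n) → ℝ :=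
      fun y => (1 + c ^ 2 * ‖y - x₀‖ ^ 2) ^ (1 - (n : ℝ) / 2) with hg
    have hgs : ContDiff ℝ 2 g := contDiff_one_add_sq_norm_rpow c _ x₀
    have hg0 : ∀ y, 0 ≤ g y := fun y => by positivity
    have hlapg : ∀ y, c ^ (n - 2) * -euclLap n g y =
        n * (n - 2) * α * (c ^ n * φ (c • (x₀ - y))) := by
      intro y
      rw [hg, euclLap_one_add_sq_norm_rpow, hφ]
      simp only [norm_smul, norm_eq_abs, mul_pow, sq_abs, norm_sub_rev x₀ y]
      have : c ^ n = c ^ (n - 2) * c ^ 2 := by rw [← pow_add]; congr 1; omega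
      rw [this, ← hp]
      field_simp
    have hgreen : ∫ x, w x * -euclLap n g x = ∫ x, -euclLap n w x * g x := by
      simp only [mul_neg, neg_mul, integral_neg, integral_mul_euclLap hw hwc hgs]
    have hle : ∫ x, -euclLap n w x * g x ≤ C * ∫ x in Ω, g x := by
      rw [← integral_const_mul, ← integral_indicator hΩopen.measurableSet]
      refine integral_mono ?_ ?_ fun x => ?_
      · have hlw : HasCompactSupport (euclLap n w) := by
          refine HasCompactSupport.intro hwc.isCompact fun x hx => ?_
          rw [euclLap_congr (notMem_tsupport_iff_eventuallyEq.1 hx)]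
          simp [euclLap]
        exact ((continuous_euclLap hw).neg.mul hgs.continuous).integrable_of_hasCompactSupport
          (HasCompactSupport.mul_right hlw.neg)
      · refine IntegrableOn.integrable_indicator ?_ hΩopen.measurableSet
        exact ((continuous_const.mul hgs.continuous).locallyIntegrable.integrableOn_isCompact
          hΩbd.isCompact_closure).mono_set subset_closure
      · refine (mul_le_mul_of_nonneg_right (hlap x) (hg0 x)).trans_eq ?_
        by_cases hx : x ∈ Ω <;> simp [hx]
    have hbt := setIntegral_one_add_sq_norm_rpow_le
      (volume : Measure (EuclideanSpace ℝ (Fin n))) (by omega) hΩopen.measurableSet hΩbd hr hc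
      x₀ hvol
    rw [hfin] at hbt
    have hmain : n * (n - 2) * α * ∫ x, (c ^ n * φ (c • (x₀ - x))) • w x ≤
        C * (n * α * (r ^ 2 / 2)) :=
      calc n * (n - 2) * α * ∫ x, (c ^ n * φ (c • (x₀ - x))) • w x
          = c ^ (n - 2) * ∫ x, w x * -euclLap n g x := by
            rw [← integral_const_mul, ← integral_const_mul]
            congr 1
            funext x
            rw [smul_eq_mul, ← mul_assoc, ← hlapg x]
            ring
        _ ≤ c ^ (n - 2) * (C * ∫ x in Ω, g x) := by
            rw [hgreen]; gcongr
        _ = C * (c ^ (n - 2) * ∫ x in Ω, g x) := by ring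
        _ ≤ C * (n * α * (r ^ 2 / 2)) := by gcongr
    rw [le_div_iff₀ (by linarith)]
    have hpos : 0 < n * α / 2 := by positivity
    refine le_of_mul_le_mul_left ?_ hpos
    linarith
  have := le_of_tendsto hlim ((eventually_gt_atTop 0).mono hbound)
  rw [le_div_iff₀ (by linarith)] at this
  linarith

/-- Faber–Krahn-type volume lower bound (non-optimal constant): if `Ω ⊂ ℝⁿ`
(`n ≥ 3`) is bounded and carries a positive Dirichlet eigenfunction with
eigenvalue `λ`, then `Vol(Ω) ≥ (2(n-2))^{n/2} αₙ λ^{-n/2}`. -/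
theorem faber_krahn_type_volume_bound
    (n : ℕ) (hn : 3 ≤ n)
    (Ω : Set (EuclideanSpace ℝ (Fin n)))
    (hΩopen : IsOpen Ω) (hΩbd : Bornology.IsBounded Ω) (hΩconn : IsConnected Ω)
    (α : ℝ) (hα : α = (volume (ball (0 : EuclideanSpace ℝ (Fin n)) 1)).toReal)
    (u : EuclideanSpace ℝ (Fin n) → ℝ) (lam : ℝ) (hlam : 0 < lam)
    (hcont : ContinuousOn u (closure Ω))
    (hsmooth : ∀ x ∈ Ω, ContDiffAt ℝ 2 u x)
    (heig : ∀ x ∈ Ω, euclLap n u x = -lam * u x)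
    (hpos : ∀ x ∈ Ω, 0 < u x)
    (hbdry : ∀ x ∈ frontier Ω, u x = 0) :
    ENNReal.ofReal ((2 * ((n : ℝ) - 2)) ^ ((n : ℝ) / 2) * α * lam ^ (-(n : ℝ) / 2)) ≤
      volume Ω := by
  have hnR : (3 : ℝ) ≤ n := by exact_mod_cast hn
  have : Nonempty (Fin n) := ⟨⟨0, by omega⟩⟩
  obtain ⟨x₀, hx₀, hmax⟩ := hΩbd.isCompact_closure.exists_isMaxOn hΩconn.nonempty.closure hcont
  have hMle : ∀ x ∈ Ω, u x ≤ u x₀ := fun x hx => hmax (subset_closure hx)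
  have hM : 0 < u x₀ := by
    obtain ⟨y, hy⟩ := hΩconn.nonempty
    exact (hpos y hy).trans_le (hMle y hy)
  have hx₀Ω : x₀ ∈ Ω := by
    by_contra h
    exact hM.ne' (hbdry x₀ ⟨hx₀, by rwa [hΩopen.interior_eq]⟩)
  have hα0 : 0 < α := hα ▸
    ENNReal.toReal_pos (measure_ball_pos _ _ one_pos).ne' measure_ball_lt_top.ne
  set V : ℝ := (volume Ω).toReal with hV
  have hVtop : volume Ω ≠ ⊤ := hΩbd.measure_lt_top.ne
  set r : ℝ := (V / α) ^ ((n : ℝ)⁻¹) with hr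
  have hVα : 0 ≤ V / α := div_nonneg ENNReal.toReal_nonneg hα0.le
  have hr0 : 0 ≤ r := rpow_nonneg hVα _
  have hrn : r ^ n = V / α := rpow_inv_natCast_pow hVα (by omega)
  have hvol : volume Ω = volume (ball x₀ r) := by
    rw [Measure.addHaar_ball _ _ hr0, finrank_euclideanSpace_fin, hrn,
      ← ENNReal.ofReal_toReal (measure_ball_lt_top (μ := volume) (x := (0 : EuclideanSpace ℝ (Fin n)))
        (r := 1)).ne, ← hα, ← ENNReal.ofReal_mul hVα, div_mul_cancel₀ _ hα0.ne',
      ENNReal.ofReal_toReal hVtop]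
  have hapx : ∀ δ : ℝ, 0 < δ → u x₀ ≤ lam * u x₀ * r ^ 2 / (2 * ((n : ℝ) - 2)) + δ := by
    intro δ hδ
    obtain ⟨w, hw, hwc, hlap, hwl⟩ := exists_compactly_supported_approx hΩopen hΩbd hlam hcont
      hsmooth heig hpos hbdry hMle (half_pos hδ)
    have h1 := le_of_neg_euclLap_le hn hΩopen hΩbd hr0 x₀ hvol hw hwc (by positivity) hlap
    have h2 := hwl x₀ hx₀Ω
    rw [mul_comm, ← le_div_iff₀ (by linarith)] at h1
    linarith
  have hle := le_of_forall_pos_le_add hapx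
  rw [le_div_iff₀ (by linarith)] at hle
  have hkey : 2 * ((n : ℝ) - 2) / lam ≤ r ^ 2 := by
    rw [div_le_iff₀ hlam]
    refine le_of_mul_le_mul_left ?_ hM
    linarith
  refine ENNReal.ofReal_le_of_le_toReal ?_
  have hb : (0 : ℝ) ≤ 2 * ((n : ℝ) - 2) := by linarith
  calc (2 * ((n : ℝ) - 2)) ^ ((n : ℝ) / 2) * α * lam ^ (-(n : ℝ) / 2)
      = α * (2 * ((n : ℝ) - 2) / lam) ^ ((n : ℝ) / 2) := by
        rw [div_rpow hb hlam.le, neg_div, rpow_neg hlam.le]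
        ring
    _ ≤ α * (r ^ 2) ^ ((n : ℝ) / 2) := by gcongr
    _ = α * r ^ n := by
        rw [← rpow_natCast r 2, ← rpow_mul hr0, Nat.cast_ofNat, mul_div_cancel₀ _ two_ne_zero,
          rpow_natCast]
    _ = V := by rw [hrn, mul_div_cancel₀ _ hα0.ne']
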